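/- Let β ∈ ℝ \ {0}, k ∈ ℝ and t > 0. Then the one-sided boundary values of Ψ_δ' at x = 0 are given by lim_{x→0^±} Ψ_δ'(t,x;k) = exp(−ik²t)·(1 ± ik/(β+ik)) ∓ (ikβ/(β²+k²))·Λ(β·√(it)) ∓ (k²/(β²+k²))·Λ(ik·√(it)), and the one-sided boundary values of the spatial derivative are given by lim_{x→0^±} ∂Ψ_δ'/∂x(t,x;k) = β·((ik/(β+ik))·exp(−ik²t) − (ikβ/(β²+k²))·Λ(β·√(it)) − (k²/(β²+k²))·Λ(ik·√(it))), with the same value for both signs. -/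

import Mathlib

/-- The modified error function `Λ(z) = exp(z²)·(1 − (2/√π)·∫₀^z exp(−ξ²) dξ)`,
where the integral is the complex line integral along the segment from `0` to `z`. -/
noncomputable def Lam (z : ℂ) : ℂ :=
  Complex.exp (z ^ 2) *
    (1 - (2 / (Real.sqrt Real.pi : ℂ)) * ∫ s in (0:ℝ)..1, z * Complex.exp (-((s : ℂ) * z) ^ 2))

/-- For `t > 0`, the principal square root of `i·t`, namely `√t·(1+i)/√2`. -/
noncomputable def sqrtit (t : ℝ) : ℂ :=
  (Real.sqrt t : ℂ) * (1 + Complex.I) / (Real.sqrt 2 : ℂ)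

/-- The free plane-wave solution `Ψ_free(t,x;k) = exp(i·k·x − i·k²·t)`. -/
noncomputable def psiFree (k t x : ℝ) : ℂ :=
  Complex.exp (Complex.I * k * x - Complex.I * k ^ 2 * t)

/-- `φ_δ(t,x;k)` from the explicit solution for the δ-potential of strength `2α`. -/
noncomputable def phiDelta (α k t x : ℝ) : ℂ :=
  ((α : ℂ) / (2 * ((α : ℂ) + Complex.I * k))) *
    Complex.exp (-(x : ℂ) ^ 2 / (4 * Complex.I * t)) *
    (Lam (((|x| : ℝ) : ℂ) / (2 * sqrtit t) + (α : ℂ) * sqrtit t)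
      - Lam (((|x| : ℝ) : ℂ) / (2 * sqrtit t) - Complex.I * k * sqrtit t))

/-- `Ψ_δ(t,x;k) = Ψ_free(t,x;k) + φ_δ(t,x;k) + φ_δ(t,−x;−k)`. -/
noncomputable def psiDelta (α k t x : ℝ) : ℂ :=
  psiFree k t x + phiDelta α k t x + phiDelta α (-k) t (-x)

/-- `φ_δ'(t,x;k)` from the explicit solution for the δ'-potential of strength `2/β`. -/
noncomputable def phiDelta' (β k t x : ℝ) : ℂ :=
  ((Real.sign x : ℂ) / (2 * ((β : ℂ) + Complex.I * k))) *
    Complex.exp (-(x : ℂ) ^ 2 / (4 * Complex.I * t)) *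
    ((β : ℂ) * Lam (((|x| : ℝ) : ℂ) / (2 * sqrtit t) + (β : ℂ) * sqrtit t)
      + Complex.I * k * Lam (((|x| : ℝ) : ℂ) / (2 * sqrtit t) - Complex.I * k * sqrtit t))

/-- `Ψ_δ'(t,x;k) = Ψ_free(t,x;k) + φ_δ'(t,x;k) + φ_δ'(t,−x;−k)`. -/
noncomputable def psiDelta' (β k t x : ℝ) : ℂ :=
  psiFree k t x + phiDelta' β k t x + phiDelta' β (-k) t (-x)

open Filter Topology

/-- `Λ` solves the differential equation `Λ' = 2zΛ − 2/√π`. -/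
theorem hasDerivAt_Lam (z : ℂ) :
    HasDerivAt Lam (2 * z * Lam z - 2 / (Real.sqrt Real.pi : ℂ)) z := by
  obtain ⟨G, hG⟩ : ∃ G : ℂ → ℂ, ∀ w : ℂ, HasDerivAt G (Complex.exp (-w ^ 2)) w := by
    have hd : Differentiable ℂ fun w : ℂ => Complex.exp (-w ^ 2) := by fun_prop
    obtain ⟨G, hG⟩ := hd.isExactOn_univ
    exact ⟨G, fun w => hG w (Set.mem_univ w)⟩
  have hint (w : ℂ) :
      ∫ s in (0:ℝ)..1, w * Complex.exp (-((s : ℂ) * w) ^ 2) = G w - G 0 := by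
    have hcurve (s : ℝ) : HasDerivAt (fun s : ℝ => G ((s : ℂ) * w))
        (w * Complex.exp (-((s : ℂ) * w) ^ 2)) s := by
      have hlin : HasDerivAt (fun s : ℂ => s * w) w (s : ℂ) := by
        simpa using (hasDerivAt_id (s : ℂ)).mul_const w
      simpa [mul_comm] using ((hG ((s : ℂ) * w)).comp (s : ℂ) hlin).comp_ofReal
    rw [intervalIntegral.integral_eq_sub_of_hasDerivAt (fun s _ => hcurve s)
      (Continuous.intervalIntegrable (by fun_prop) 0 1)]
    simp
  have hLam : Lam = fun w => Complex.exp (w ^ 2) *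
      (1 - (2 / (Real.sqrt Real.pi : ℂ)) * (G w - G 0)) := by
    funext w
    rw [Lam, hint]
  have hexp : Complex.exp (z ^ 2) * Complex.exp (-z ^ 2) = 1 := by
    rw [← Complex.exp_add, add_neg_cancel, Complex.exp_zero]
  rw [hLam]
  have hsq : HasDerivAt (fun w : ℂ => Complex.exp (w ^ 2))
      (Complex.exp (z ^ 2) * (2 * z)) z := by
    simpa using (hasDerivAt_pow 2 z).cexp
  refine (hsq.mul ((((hG z).sub_const (G 0)).const_mul
    (2 / (Real.sqrt Real.pi : ℂ))).const_sub 1)).congr_deriv ?_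
  linear_combination (-(2 / (Real.sqrt Real.pi : ℂ))) * hexp

theorem continuous_Lam : Continuous Lam :=
  continuous_iff_continuousAt.2 fun z => (hasDerivAt_Lam z).continuousAt

theorem Lam_neg (z : ℂ) : Lam (-z) = 2 * Complex.exp (z ^ 2) - Lam z := by
  simp only [Lam, mul_neg, neg_mul, neg_sq, intervalIntegral.integral_neg]
  ring

theorem sqrtit_sq {t : ℝ} (ht : 0 ≤ t) : sqrtit t ^ 2 = Complex.I * t := by
  have h1 : ((Real.sqrt t : ℝ) : ℂ) ^ 2 = t := by
    rw [← Complex.ofReal_pow, Real.sq_sqrt ht]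
  have h2 : ((Real.sqrt 2 : ℝ) : ℂ) ^ 2 = 2 := by
    rw [← Complex.ofReal_pow, Real.sq_sqrt zero_le_two, Complex.ofReal_ofNat]
  rw [sqrtit, div_pow, mul_pow, h1, h2]
  linear_combination (t / 2 : ℂ) * Complex.I_sq

theorem sqrtit_ne_zero {t : ℝ} (ht : 0 < t) : sqrtit t ≠ 0 := by
  intro h
  have := sqrtit_sq ht.le
  simp [h, ht.ne'] at this

/-- The Gaussian-weighted profile `exp(−x²/(4it))·Λ(σx/(2√(it)) + γ√(it))` out of which `φ_δ'` is
built; the sign `σ` selects the half-line. -/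
noncomputable def profile (t : ℝ) (σ γ : ℂ) (x : ℝ) : ℂ :=
  Complex.exp (-(x : ℂ) ^ 2 / (4 * Complex.I * t)) *
    Lam (σ * x / (2 * sqrtit t) + γ * sqrtit t)

theorem continuous_profile (t : ℝ) (σ γ : ℂ) : Continuous (profile t σ γ) := by
  have := continuous_Lam
  unfold profile
  fun_prop

theorem profile_zero (t : ℝ) (σ γ : ℂ) : profile t σ γ 0 = Lam (γ * sqrtit t) := by
  simp [profile]

theorem hasDerivAt_profile {t : ℝ} (ht : 0 < t) {σ : ℂ} (hσ : σ ^ 2 = 1) (γ : ℂ) (x : ℝ) :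
    HasDerivAt (profile t σ γ)
      (σ * (γ * profile t σ γ x - Complex.exp (-(x : ℂ) ^ 2 / (4 * Complex.I * t)) /
        (sqrtit t * (Real.sqrt Real.pi : ℂ)))) x := by
  have hS := sqrtit_ne_zero ht
  have hπ : (Real.sqrt Real.pi : ℂ) ≠ 0 :=
    Complex.ofReal_ne_zero.2 (Real.sqrt_pos.2 Real.pi_pos).ne'
  have hgauss : HasDerivAt (fun y : ℂ => Complex.exp (-y ^ 2 / (4 * Complex.I * t)))
      (Complex.exp (-(x : ℂ) ^ 2 / (4 * Complex.I * t)) * (-(2 * x) / (4 * Complex.I * t)))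
      (x : ℂ) := by
    simpa using (((hasDerivAt_pow 2 (x : ℂ)).neg).div_const (4 * Complex.I * t)).cexp
  have hlin : HasDerivAt (fun y : ℂ => σ * y / (2 * sqrtit t) + γ * sqrtit t)
      (σ / (2 * sqrtit t)) (x : ℂ) := by
    simpa using (((hasDerivAt_id (x : ℂ)).const_mul σ).div_const (2 * sqrtit t)).add_const
      (γ * sqrtit t)
  refine ((hgauss.mul ((hasDerivAt_Lam _).comp (x : ℂ) hlin)).comp_ofReal).congr_deriv ?_
  simp only [profile, Function.comp]
  have hit : 4 * Complex.I * t = 4 * sqrtit t ^ 2 := by rw [sqrtit_sq ht.le]; ring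
  rw [hit]
  generalize Complex.exp _ = E
  generalize Lam _ = L
  field_simp
  linear_combination (4 * (Real.sqrt Real.pi : ℂ) * x * E * L) * hσ

/-- The smooth function agreeing with `Ψ_δ'` on the half-line `0 < σx`. -/
noncomputable def psiBranch (β k t : ℝ) (σ : ℂ) (x : ℝ) : ℂ :=
  psiFree k t x +
    σ * ((β * profile t σ β x + Complex.I * k * profile t σ (-(Complex.I * k)) x) /
        (2 * ((β : ℂ) + Complex.I * k)) -
      (β * profile t σ β x - Complex.I * k * profile t σ (Complex.I * k) x) /
        (2 * ((β : ℂ) - Complex.I * k)))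

theorem psiDelta'_of_pos (β k t : ℝ) {x : ℝ} (hx : 0 < x) :
    psiDelta' β k t x = psiBranch β k t 1 x := by
  simp only [psiDelta', phiDelta', psiBranch, profile, Real.sign_of_pos hx,
    Real.sign_of_neg (neg_neg_of_pos hx), abs_neg, abs_of_pos hx]
  push_cast
  simp only [neg_sq, mul_neg, neg_mul, one_mul, sub_neg_eq_add, ← sub_eq_add_neg]
  ring

theorem psiDelta'_of_neg (β k t : ℝ) {x : ℝ} (hx : x < 0) :
    psiDelta' β k t x = psiBranch β k t (-1) x := by
  simp only [psiDelta', phiDelta', psiBranch, profile, Real.sign_of_neg hx,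
    Real.sign_of_pos (neg_pos_of_neg hx), abs_neg, abs_of_neg hx]
  push_cast
  simp only [neg_sq, mul_neg, neg_mul, one_mul, sub_neg_eq_add, ← sub_eq_add_neg]
  ring

theorem continuous_psiFree (k t : ℝ) : Continuous (psiFree k t) := by
  unfold psiFree
  fun_prop

theorem hasDerivAt_psiFree (k t x : ℝ) :
    HasDerivAt (psiFree k t) (Complex.I * k * psiFree k t x) x := by
  have h : HasDerivAt (fun y : ℂ => Complex.exp (Complex.I * k * y - Complex.I * k ^ 2 * t))
      (Complex.exp (Complex.I * k * x - Complex.I * k ^ 2 * t) * (Complex.I * k)) (x : ℂ) := by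
    simpa using (((hasDerivAt_id (x : ℂ)).const_mul (Complex.I * k)).sub_const
      (Complex.I * k ^ 2 * t)).cexp
  exact h.comp_ofReal.congr_deriv (mul_comm _ _)

theorem psiFree_zero (k t : ℝ) : psiFree k t 0 = Complex.exp (-Complex.I * k ^ 2 * t) := by
  simp [psiFree]

theorem continuous_psiBranch (β k t : ℝ) (σ : ℂ) : Continuous (psiBranch β k t σ) := by
  have := continuous_psiFree k t
  have := continuous_profile t σ
  unfold psiBranch
  fun_prop

theorem add_I_mul_ne_zero {β : ℝ} (hβ : β ≠ 0) (k : ℝ) : (β : ℂ) + Complex.I * k ≠ 0 := by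
  intro h
  simpa [hβ] using congrArg Complex.re h

theorem sub_I_mul_ne_zero {β : ℝ} (hβ : β ≠ 0) (k : ℝ) : (β : ℂ) - Complex.I * k ≠ 0 := by
  intro h
  simpa [hβ] using congrArg Complex.re h

theorem sq_add_sq_eq_mul (β k : ℝ) :
    (β : ℂ) ^ 2 + (k : ℂ) ^ 2 = ((β : ℂ) + Complex.I * k) * ((β : ℂ) - Complex.I * k) := by
  linear_combination (k : ℂ) ^ 2 * Complex.I_sq

theorem Lam_neg_I_mul_sqrtit (k : ℝ) {t : ℝ} (ht : 0 ≤ t) :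
    Lam (-(Complex.I * k) * sqrtit t) =
      2 * Complex.exp (-Complex.I * k ^ 2 * t) - Lam (Complex.I * k * sqrtit t) := by
  rw [neg_mul, Lam_neg]
  congr 3
  rw [mul_pow, mul_pow, sqrtit_sq ht, Complex.I_sq]
  ring

theorem psiBranch_zero {β : ℝ} (hβ : β ≠ 0) (k : ℝ) {t : ℝ} (ht : 0 ≤ t) (σ : ℂ) :
    psiBranch β k t σ 0 =
      Complex.exp (-Complex.I * k ^ 2 * t) + σ *
        (Complex.I * k / ((β : ℂ) + Complex.I * k) * Complex.exp (-Complex.I * k ^ 2 * t)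
          - (Complex.I * k * β / ((β : ℂ) ^ 2 + (k : ℂ) ^ 2)) * Lam ((β : ℂ) * sqrtit t)
          - ((k : ℂ) ^ 2 / ((β : ℂ) ^ 2 + (k : ℂ) ^ 2)) * Lam (Complex.I * k * sqrtit t)) := by
  have h1 := add_I_mul_ne_zero hβ k
  have h2 := sub_I_mul_ne_zero hβ k
  rw [psiBranch, psiFree_zero, profile_zero, profile_zero, profile_zero,
    Lam_neg_I_mul_sqrtit k ht, sq_add_sq_eq_mul]
  congr 2
  generalize Complex.exp _ = E
  generalize Lam (β * _) = A
  generalize Lam _ = B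
  field_simp
  linear_combination (2 * (k : ℂ) ^ 2 * B) * Complex.I_sq

theorem hasDerivAt_psiBranch {β : ℝ} (hβ : β ≠ 0) (k : ℝ) {t : ℝ} (ht : 0 < t) {σ : ℂ}
    (hσ : σ ^ 2 = 1) (x : ℝ) :
    HasDerivAt (psiBranch β k t σ)
      (Complex.I * k * psiFree k t x +
        ((β ^ 2 * profile t σ β x + k ^ 2 * profile t σ (-(Complex.I * k)) x) /
            (2 * ((β : ℂ) + Complex.I * k)) -
          (β ^ 2 * profile t σ β x + k ^ 2 * profile t σ (Complex.I * k) x) /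
            (2 * ((β : ℂ) - Complex.I * k)))) x := by
  have h1 := add_I_mul_ne_zero hβ k
  have h2 := sub_I_mul_ne_zero hβ k
  have hβp := hasDerivAt_profile ht hσ β x
  have hneg := hasDerivAt_profile ht hσ (-(Complex.I * k)) x
  have hpos := hasDerivAt_profile ht hσ (Complex.I * k) x
  refine ((hasDerivAt_psiFree k t x).add
    (((((hβp.const_mul (β : ℂ)).add (hneg.const_mul (Complex.I * k))).div_const
      (2 * ((β : ℂ) + Complex.I * k))).sub
    (((hβp.const_mul (β : ℂ)).sub (hpos.const_mul (Complex.I * k))).div_const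
      (2 * ((β : ℂ) - Complex.I * k)))).const_mul σ)).congr_deriv ?_
  congr 1
  generalize Complex.exp _ / _ = E
  generalize profile t σ β x = A
  generalize profile t σ (-(Complex.I * k)) x = B
  generalize profile t σ (Complex.I * k) x = C
  have hk : (k : ℂ) ^ 2 = -(Complex.I * k) ^ 2 := by
    rw [mul_pow, Complex.I_sq]
    ring
  rw [hk]
  generalize Complex.I * (k : ℂ) = κ at *
  field_simp
  rw [hσ]
  ring

theorem deriv_psiBranch_zero {β : ℝ} (hβ : β ≠ 0) (k : ℝ) {t : ℝ} (ht : 0 < t) {σ : ℂ}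
    (hσ : σ ^ 2 = 1) :
    deriv (psiBranch β k t σ) 0 = (β : ℂ) *
      ((Complex.I * k / ((β : ℂ) + Complex.I * k)) * Complex.exp (-Complex.I * k ^ 2 * t)
        - (Complex.I * k * β / ((β : ℂ) ^ 2 + (k : ℂ) ^ 2)) * Lam ((β : ℂ) * sqrtit t)
        - ((k : ℂ) ^ 2 / ((β : ℂ) ^ 2 + (k : ℂ) ^ 2)) * Lam (Complex.I * k * sqrtit t)) := by
  have h1 := add_I_mul_ne_zero hβ k
  have h2 := sub_I_mul_ne_zero hβ k
  rw [(hasDerivAt_psiBranch hβ k ht hσ 0).deriv, psiFree_zero, profile_zero, profile_zero,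
    profile_zero, Lam_neg_I_mul_sqrtit k ht.le, sq_add_sq_eq_mul]
  generalize Complex.exp _ = E
  generalize Lam (β * _) = A
  generalize Lam _ = B
  have hk : (k : ℂ) ^ 2 = -(Complex.I * k) ^ 2 := by
    rw [mul_pow, Complex.I_sq]
    ring
  rw [hk]
  generalize Complex.I * (k : ℂ) = κ at *
  field_simp
  ring

theorem continuous_deriv_psiBranch {β : ℝ} (hβ : β ≠ 0) (k : ℝ) {t : ℝ} (ht : 0 < t) {σ : ℂ}
    (hσ : σ ^ 2 = 1) : Continuous (deriv (psiBranch β k t σ)) := by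
  have := continuous_psiFree k t
  have := continuous_profile t σ
  rw [funext fun x => (hasDerivAt_psiBranch hβ k ht hσ x).deriv]
  fun_prop

/-- If `f` agrees with a function `g` of class `C¹` on an open set `s`, then the values and the
derivatives of `f` within `s` tend to those of `g`. -/
theorem tendsto_and_tendsto_deriv_of_eqOn {f g : ℝ → ℂ} {s : Set ℝ} (hs : IsOpen s)
    (hfg : Set.EqOn f g s) (hg : Continuous g) (hg' : Continuous (deriv g)) (a : ℝ) :
    Tendsto f (𝓝[s] a) (𝓝 (g a)) ∧ Tendsto (deriv f) (𝓝[s] a) (𝓝 (deriv g a)) := by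
  refine ⟨((hg.tendsto a).mono_left nhdsWithin_le_nhds).congr' ?_,
    ((hg'.tendsto a).mono_left nhdsWithin_le_nhds).congr' ?_⟩
  · filter_upwards [self_mem_nhdsWithin] with x hx using (hfg hx).symm
  · filter_upwards [self_mem_nhdsWithin] with x hx
    exact ((hfg.eventuallyEq_of_mem (hs.mem_nhds hx)).deriv_eq).symm

/-- One-sided boundary values of `Ψ_δ'` and of its spatial derivative at `x = 0`:
`Ψ_δ'(t,0^±;k) = exp(−ik²t)·(1 ± ik/(β+ik)) ∓ (ikβ/(β²+k²))·Λ(β√(it)) ∓ (k²/(β²+k²))·Λ(ik√(it))`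
and `∂ₓΨ_δ'(t,0^±;k) = β·((ik/(β+ik))·exp(−ik²t) − (ikβ/(β²+k²))·Λ(β√(it)) − (k²/(β²+k²))·Λ(ik√(it)))`,
the latter with the same value from both sides. -/
theorem psiDelta'_boundary_values (β k t : ℝ) (hβ : β ≠ 0) (ht : 0 < t) :
    Tendsto (fun x : ℝ => psiDelta' β k t x) (nhdsWithin 0 (Set.Ioi 0))
      (nhds (Complex.exp (-Complex.I * k ^ 2 * t) *
            (1 + Complex.I * k / ((β : ℂ) + Complex.I * k))
          - (Complex.I * k * β / ((β : ℂ) ^ 2 + (k : ℂ) ^ 2)) * Lam ((β : ℂ) * sqrtit t)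
          - ((k : ℂ) ^ 2 / ((β : ℂ) ^ 2 + (k : ℂ) ^ 2)) * Lam (Complex.I * k * sqrtit t))) ∧
    Tendsto (fun x : ℝ => psiDelta' β k t x) (nhdsWithin 0 (Set.Iio 0))
      (nhds (Complex.exp (-Complex.I * k ^ 2 * t) *
            (1 - Complex.I * k / ((β : ℂ) + Complex.I * k))
          + (Complex.I * k * β / ((β : ℂ) ^ 2 + (k : ℂ) ^ 2)) * Lam ((β : ℂ) * sqrtit t)
          + ((k : ℂ) ^ 2 / ((β : ℂ) ^ 2 + (k : ℂ) ^ 2)) * Lam (Complex.I * k * sqrtit t))) ∧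
    Tendsto (fun x : ℝ => deriv (fun y : ℝ => psiDelta' β k t y) x)
      (nhdsWithin 0 (Set.Ioi 0))
      (nhds ((β : ℂ) *
        ((Complex.I * k / ((β : ℂ) + Complex.I * k)) * Complex.exp (-Complex.I * k ^ 2 * t)
          - (Complex.I * k * β / ((β : ℂ) ^ 2 + (k : ℂ) ^ 2)) * Lam ((β : ℂ) * sqrtit t)
          - ((k : ℂ) ^ 2 / ((β : ℂ) ^ 2 + (k : ℂ) ^ 2)) * Lam (Complex.I * k * sqrtit t)))) ∧
    Tendsto (fun x : ℝ => deriv (fun y : ℝ => psiDelta' β k t y) x)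
      (nhdsWithin 0 (Set.Iio 0))
      (nhds ((β : ℂ) *
        ((Complex.I * k / ((β : ℂ) + Complex.I * k)) * Complex.exp (-Complex.I * k ^ 2 * t)
          - (Complex.I * k * β / ((β : ℂ) ^ 2 + (k : ℂ) ^ 2)) * Lam ((β : ℂ) * sqrtit t)
          - ((k : ℂ) ^ 2 / ((β : ℂ) ^ 2 + (k : ℂ) ^ 2)) * Lam (Complex.I * k * sqrtit t)))) := by
  have hσ : (-1 : ℂ) ^ 2 = 1 := by norm_num
  obtain ⟨hp, hp'⟩ := tendsto_and_tendsto_deriv_of_eqOn isOpen_Ioi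
    (fun x hx => psiDelta'_of_pos β k t hx) (continuous_psiBranch β k t 1)
    (continuous_deriv_psiBranch hβ k ht (one_pow 2)) 0
  obtain ⟨hn, hn'⟩ := tendsto_and_tendsto_deriv_of_eqOn isOpen_Iio
    (fun x hx => psiDelta'_of_neg β k t hx) (continuous_psiBranch β k t (-1))
    (continuous_deriv_psiBranch hβ k ht hσ) 0
  rw [psiBranch_zero hβ k ht.le] at hp hn
  rw [deriv_psiBranch_zero hβ k ht (one_pow 2)] at hp'
  rw [deriv_psiBranch_zero hβ k ht hσ] at hn'
  refine ⟨?_, ?_, hp', hn'⟩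
  · convert hp using 2
    ring
  · convert hn using 2
    ring
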